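/- Let Δ, x, y be integers with Δ ≥ 2, 0 ≤ x ≤ Δ-1 and 1 ≤ y ≤ Δ-1. Then neither the constant multiset of Δ copies of M nor the constant multiset of Δ copies of P is a black configuration of Φ_Δ(x,y). Consequently, since M occurs in every white configuration of the first kind and P occurs in every white configuration of the second kind, every white configuration of Φ_Δ(x,y) contains a label ℓ such that the multiset of Δ copies of ℓ is not a black configuration of Φ_Δ(x,y). -/

import Mathlib

/-- The four-element alphabet {M, P, O, X}. -/
inductive Label4 where
  | M | P | O | X
deriving DecidableEq

open Label4

/-- Black configurations of Φ_Δ(x,y). -/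
def blackPhi (Δ x y : ℕ) (w : Multiset Label4) : Prop :=
  (∃ s u, w = s + (M ::ₘ u) ∧ Multiset.card s = y - 1 ∧
    Multiset.card u = Δ - y ∧ ∀ l ∈ u, l ∈ ({P, O, X} : Finset Label4)) ∨
  (∃ s, w = s + Multiset.replicate (Δ - x) O ∧ Multiset.card s = x ∧
    ∀ l ∈ s, l ∈ ({O, X} : Finset Label4))

/-- White configurations of Φ_Δ(x,y): the first kind has one `M` together with
`y-1` labels over {M,O,X} and `Δ-y` labels over {O,X}; the second kind has `x`
labels over {P,X} and `Δ-x` copies of `P`. -/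
def whitePhi (Δ x y : ℕ) (w : Multiset Label4) : Prop :=
  (∃ s u, w = s + (M ::ₘ u) ∧ Multiset.card s = y - 1 ∧
    (∀ l ∈ s, l ∈ ({M, O, X} : Finset Label4)) ∧
    Multiset.card u = Δ - y ∧ ∀ l ∈ u, l ∈ ({O, X} : Finset Label4)) ∨
  (∃ s, w = s + Multiset.replicate (Δ - x) P ∧ Multiset.card s = x ∧
    ∀ l ∈ s, l ∈ ({P, X} : Finset Label4))

theorem stmt4 (Δ x y : ℕ) (hΔ : 2 ≤ Δ) (hx : x ≤ Δ - 1) (hy1 : 1 ≤ y) (hy2 : y ≤ Δ - 1) :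
    ¬ blackPhi Δ x y (Multiset.replicate Δ M) ∧
    ¬ blackPhi Δ x y (Multiset.replicate Δ P) ∧
    ∀ w : Multiset Label4, whitePhi Δ x y w →
      ∃ l ∈ w, ¬ blackPhi Δ x y (Multiset.replicate Δ l) := by
  have eq_of_mem : ∀ {l a : Label4} {w : Multiset Label4},
      Multiset.replicate Δ l = w → a ∈ w → a = l := by
    intro l a w h ha
    exact Multiset.eq_of_mem_replicate (h ▸ ha)
  have hO : ∀ s : Multiset Label4, O ∈ s + Multiset.replicate (Δ - x) O := fun s =>
    Multiset.mem_add.2 (Or.inr (Multiset.mem_replicate.2 ⟨by omega, rfl⟩))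
  have hM : ¬ blackPhi Δ x y (Multiset.replicate Δ M) := by
    rintro (⟨s, u, h, -, hu, hu'⟩ | ⟨s, h, -, -⟩)
    · obtain ⟨a, ha⟩ := Multiset.card_pos_iff_exists_mem.1 (show 0 < Multiset.card u by omega)
      have haM : a = M := eq_of_mem h (by simp [ha])
      have := hu' a ha
      simp [haM] at this
    · exact absurd (eq_of_mem h (hO s)) (by decide)
  have hP : ¬ blackPhi Δ x y (Multiset.replicate Δ P) := by
    rintro (⟨s, u, h, -, -, -⟩ | ⟨s, h, -, -⟩)
    · exact absurd (eq_of_mem h (show M ∈ s + (M ::ₘ u) by simp)) (by decide)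
    · exact absurd (eq_of_mem h (hO s)) (by decide)
  refine ⟨hM, hP, ?_⟩
  rintro w (⟨s, u, rfl, -⟩ | ⟨s, rfl, -⟩)
  · exact ⟨M, by simp, hM⟩
  · exact ⟨P, Multiset.mem_add.2 (Or.inr (Multiset.mem_replicate.2 ⟨by omega, rfl⟩)), hP⟩
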